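/- arXiv:2002.00220 — 3 statements merged into one kernel-verified Lean document; each statement's English description precedes it below -/
import Mathlib

section
/- Let U be a real Hilbert space, W ⊆ U a finite-dimensional subspace with orthogonal projection P_W and orthogonal complement W⊥, and let U_n ⊆ U be a finite-dimensional subspace with U_n ∩ W⊥ = {0}. Then for every w ∈ W there exists a unique u* in the affine space w + W⊥ minimizing u ↦ dist(u, U_n) = ‖u − P_{U_n} u‖ over w + W⊥. -/
/-- Pythagoras for three pairwise orthogonal vectors, two of which lie in `W` and one in `Wᗮ`. -/
theorem norm_add_sub_sq_of_mem_orthogonal {U : Type*} [NormedAddCommGroup U]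
    [InnerProductSpace ℝ U] {W : Submodule ℝ U} {a b z : U} (ha : a ∈ W) (hb : b ∈ W)
    (hz : z ∈ Wᗮ) (hab : inner ℝ a b = 0) :
    ‖a - b + z‖ ^ 2 = ‖a‖ ^ 2 + ‖b‖ ^ 2 + ‖z‖ ^ 2 := by
  have h : inner ℝ (a - b) z = 0 := hz _ (W.sub_mem ha hb)
  rw [norm_add_sq_real, norm_sub_sq_real, h, hab]
  ring

/-- The least-squares fit of `w` by projections `P_W v`, `v ∈ V`, satisfies the normal equations. -/
theorem exists_mem_forall_inner_sub_starProjection_eq_zero {U : Type*} [NormedAddCommGroup U]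
    [InnerProductSpace ℝ U] (W : Submodule ℝ U) [W.HasOrthogonalProjection]
    (V : Submodule ℝ U) [FiniteDimensional ℝ V] (w : U) :
    ∃ v₀ ∈ V, ∀ v ∈ V, inner ℝ (w - W.starProjection v₀) (W.starProjection v) = 0 := by
  let K : Submodule ℝ U := V.map (W.starProjection : U →ₗ[ℝ] U)
  obtain ⟨v₀, hv₀, h⟩ : K.starProjection w ∈ K := K.starProjection_apply_mem w
  refine ⟨v₀, hv₀, fun v hv => ?_⟩
  have h' : W.starProjection v₀ = K.starProjection w := h
  rw [h']
  exact K.starProjection_inner_eq_zero w _ ⟨v, hv, rfl⟩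


/-- One-space (PBDW) minimizer: if `U_n ∩ W⊥ = {0}`, then for every measurement `w ∈ W`
there is a unique element of the affine space `w + W⊥` minimizing the distance to `U_n`. -/
theorem pbdw_minimizer_exists_unique
    {U : Type*} [NormedAddCommGroup U] [InnerProductSpace ℝ U]
    (W : Submodule ℝ U) [FiniteDimensional ℝ W]
    (Un : Submodule ℝ U) [FiniteDimensional ℝ Un]
    (hUW : Un ⊓ Wᗮ = ⊥) :
    ∀ w : W, ∃! ustar : U, (ustar - (w : U)) ∈ Wᗮ ∧
      ∀ u : U, (u - (w : U)) ∈ Wᗮ →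
        Metric.infDist ustar (Un : Set U) ≤ Metric.infDist u (Un : Set U) := by
  intro w
  obtain ⟨v₀, hv₀, horth⟩ := exists_mem_forall_inner_sub_starProjection_eq_zero W Un (w : U)
  set P := W.starProjection
  have hPmem (x : U) : P x ∈ W := W.starProjection_apply_mem x
  have hPsub (x : U) : x - P x ∈ Wᗮ := W.sub_starProjection_mem_orthogonal x
  have key (u : U) (hu : u - (w : U) ∈ Wᗮ) (v : U) (hv : v ∈ Un) :
      ‖u - v‖ ^ 2 = ‖(w : U) - P v₀‖ ^ 2 + ‖P (v - v₀)‖ ^ 2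
        + ‖(u - (w : U)) - (v - P v)‖ ^ 2 := by
    rw [← norm_add_sub_sq_of_mem_orthogonal (W.sub_mem w.2 (hPmem v₀)) (hPmem (v - v₀))
      (Wᗮ.sub_mem hu (hPsub v)) (horth _ (Un.sub_mem hv hv₀)), map_sub]
    congr 2
    abel
  have lower (u : U) (hu : u - (w : U) ∈ Wᗮ) :
      ‖(w : U) - P v₀‖ ≤ Metric.infDist u (Un : Set U) := by
    refine (Metric.le_infDist ⟨0, Un.zero_mem⟩).2 fun {v} hv => ?_
    rw [dist_eq_norm]
    refine le_of_sq_le_sq ?_ (norm_nonneg _)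
    rw [key u hu v hv]
    nlinarith [sq_nonneg ‖P (v - v₀)‖, sq_nonneg ‖(u - (w : U)) - (v - P v)‖]
  have hmem : (w : U) + (v₀ - P v₀) - (w : U) ∈ Wᗮ := by simpa using hPsub v₀
  have upper : Metric.infDist ((w : U) + (v₀ - P v₀)) (Un : Set U) ≤ ‖(w : U) - P v₀‖ := by
    refine (Metric.infDist_le_dist_of_mem hv₀).trans_eq ?_
    rw [dist_eq_norm]
    congr 1
    abel
  refine ⟨(w : U) + (v₀ - P v₀), ⟨hmem, fun u hu => upper.trans (lower u hu)⟩, ?_⟩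
  rintro y ⟨hy, hmin⟩
  obtain ⟨v, hv, hdist⟩ : ∃ v ∈ Un, Metric.infDist y (Un : Set U) = ‖y - v‖ := by
    refine ⟨Un.starProjection y, Un.starProjection_apply_mem y, le_antisymm ?_ ?_⟩
    · rw [← dist_eq_norm]
      exact Metric.infDist_le_dist_of_mem (Un.starProjection_apply_mem y)
    · refine (Metric.le_infDist ⟨0, Un.zero_mem⟩).2 fun {x} hx => ?_
      rw [dist_eq_norm, Un.starProjection_minimal]
      exact ciInf_le ⟨0, by rintro _ ⟨x, rfl⟩; exact norm_nonneg _⟩ (⟨x, hx⟩ : Un)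
  have hle : ‖y - v‖ ^ 2 ≤ ‖(w : U) - P v₀‖ ^ 2 := by
    have := (hmin _ hmem).trans upper
    rw [hdist] at this
    gcongr
  rw [key y hy v hv] at hle
  have hPv : P (v - v₀) = 0 := by
    rw [← norm_eq_zero, ← sq_eq_zero_iff]
    nlinarith [sq_nonneg ‖P (v - v₀)‖, sq_nonneg ‖(y - (w : U)) - (v - P v)‖]
  have hz : (y - (w : U)) - (v - P v) = 0 := by
    rw [← norm_eq_zero, ← sq_eq_zero_iff]
    nlinarith [sq_nonneg ‖P (v - v₀)‖, sq_nonneg ‖(y - (w : U)) - (v - P v)‖]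
  have hvv : v - v₀ ∈ Un ⊓ Wᗮ :=
    ⟨Un.sub_mem hv hv₀, by simpa [hPv] using hPsub (v - v₀)⟩
  rw [hUW, Submodule.mem_bot, sub_eq_zero] at hvv
  subst hvv
  rw [← sub_eq_zero, ← hz]
  abel
end

section
/- Let U be a real Hilbert space, W ⊆ U a finite-dimensional subspace with orthogonal complement W⊥, and U_n ⊆ U a finite-dimensional subspace with U_n ∩ W⊥ = {0}. Then the one-space (PBDW) map A_{U_n} : W → U, which sends each w ∈ W to the unique minimizer of u ↦ dist(u, U_n) over the affine space w + W⊥, is linear: A_{U_n}(w₁ + w₂) = A_{U_n}(w₁) + A_{U_n}(w₂) and A_{U_n}(λw) = λ A_{U_n}(w) for all w, w₁, w₂ ∈ W and λ ∈ ℝ. -/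
/-- The distance to a subspace is the norm of the orthogonal component. -/
theorem Submodule.infDist_eq_norm_starProjection_orthogonal
    {U : Type*} [NormedAddCommGroup U] [InnerProductSpace ℝ U]
    (V : Submodule ℝ U) [V.HasOrthogonalProjection] (u : U) :
    Metric.infDist u (V : Set U) = ‖Vᗮ.starProjection u‖ := by
  rw [Metric.infDist_eq_iInf, V.starProjection_orthogonal_val, V.starProjection_minimal u]
  simp only [dist_eq_norm]
  rfl

/-- A vector that is not shortened by adding any multiple of `y` is orthogonal to `y`. -/
theorem real_inner_eq_zero_of_forall_norm_le_norm_add_smul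
    {U : Type*} [NormedAddCommGroup U] [InnerProductSpace ℝ U] {x y : U}
    (h : ∀ t : ℝ, ‖x‖ ≤ ‖x + t • y‖) : inner ℝ x y = 0 := by
  have key : ∀ t : ℝ, 0 ≤ ‖y‖ ^ 2 * (t * t) + (2 * inner ℝ x y) * t + 0 := fun t ↦ by
    have h₁ : ‖x‖ ^ 2 ≤ ‖x + t • y‖ ^ 2 := by gcongr; exact h t
    rw [norm_add_sq_real, real_inner_smul_right, norm_smul, mul_pow, Real.norm_eq_abs,
      sq_abs] at h₁
    linarith
  have h₂ := discrim_le_zero key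
  rw [discrim] at h₂
  nlinarith [sq_nonneg (inner ℝ x y)]

/-- If `Un ⊓ Wᗮ = ⊥`, a vector of `Wᗮ` whose component orthogonal to `Un` is orthogonal to those
of all vectors of `Wᗮ` vanishes. -/
theorem Submodule.eq_zero_of_forall_inner_starProjection_orthogonal
    {U : Type*} [NormedAddCommGroup U] [InnerProductSpace ℝ U]
    {V X : Submodule ℝ U} [V.HasOrthogonalProjection] (h : V ⊓ X = ⊥) {d : U} (hd : d ∈ X)
    (horth : ∀ v ∈ X, inner ℝ (Vᗮ.starProjection d) (Vᗮ.starProjection v) = 0) : d = 0 := by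
  have h₀ : Vᗮ.starProjection d = 0 := inner_self_eq_zero.mp (horth d hd)
  rw [V.starProjection_orthogonal_val, sub_eq_zero] at h₀
  have hV : d ∈ V := V.starProjection_eq_self_iff.mp h₀.symm
  exact (Submodule.mem_bot ℝ).mp (h ▸ ⟨hV, hd⟩)

/-- Linearity of the one-space (PBDW) recovery map: if `A : W → U` sends each `w` to the
(unique) minimizer of the distance to `U_n` over the affine space `w + W⊥`, and
`U_n ∩ W⊥ = {0}`, then `A` is additive and homogeneous. -/
theorem pbdw_map_linear
    {U : Type*} [NormedAddCommGroup U] [InnerProductSpace ℝ U]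
    (W : Submodule ℝ U) [FiniteDimensional ℝ W]
    (Un : Submodule ℝ U) [FiniteDimensional ℝ Un]
    (hUW : Un ⊓ Wᗮ = ⊥)
    (A : W → U)
    (hA : ∀ w : W, (A w - (w : U)) ∈ Wᗮ ∧
      ∀ u : U, (u - (w : U)) ∈ Wᗮ →
        Metric.infDist (A w) (Un : Set U) ≤ Metric.infDist u (Un : Set U)) :
    (∀ w₁ w₂ : W, A (w₁ + w₂) = A w₁ + A w₂) ∧
    (∀ (lam : ℝ) (w : W), A (lam • w) = lam • A w) := by
  have horth : ∀ w : W, ∀ v ∈ Wᗮ,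
      inner ℝ (Unᗮ.starProjection (A w)) (Unᗮ.starProjection v) = 0 := fun w v hv ↦ by
    refine real_inner_eq_zero_of_forall_norm_le_norm_add_smul fun t ↦ ?_
    have h := (hA w).2 (A w + t • v) (by
      rw [add_sub_right_comm]
      exact add_mem (hA w).1 (Wᗮ.smul_mem t hv))
    rwa [Un.infDist_eq_norm_starProjection_orthogonal,
      Un.infDist_eq_norm_starProjection_orthogonal, map_add, map_smul] at h
  refine ⟨fun w₁ w₂ ↦ sub_eq_zero.mp ?_, fun lam w ↦ sub_eq_zero.mp ?_⟩
  · refine Submodule.eq_zero_of_forall_inner_starProjection_orthogonal hUW ?_ fun v hv ↦ ?_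
    · have h := sub_mem (hA (w₁ + w₂)).1 (add_mem (hA w₁).1 (hA w₂).1)
      convert h using 1
      push_cast
      abel
    · simp only [map_sub, map_add, inner_sub_left, inner_add_left, horth _ v hv, add_zero,
        sub_zero]
  · refine Submodule.eq_zero_of_forall_inner_starProjection_orthogonal hUW ?_ fun v hv ↦ ?_
    · have h := sub_mem (hA (lam • w)).1 (Wᗮ.smul_mem lam (hA w).1)
      convert h using 1
      push_cast
      module
    · simp only [map_sub, map_smul, inner_sub_left, real_inner_smul_left, horth _ v hv, mul_zero,
        sub_zero]
end

section
/- Let U be a real Hilbert space, W ⊆ U a finite-dimensional subspace with orthogonal projection P_W and orthogonal complement W⊥, and U_n ⊆ U a finite-dimensional subspace with U_n ∩ W⊥ = {0}. Fix ε ≥ 0 and w ∈ W such that the cylinder slice K_w := K(U_n, ε) ∩ (w + W⊥) is nonempty. Then the one-space estimate u*(w) = A_{U_n}(w) belongs to K_w and is a Chebyshev center of K_w: for every c ∈ U, sup_{v ∈ K_w} ‖v − u*(w)‖ ≤ sup_{v ∈ K_w} ‖v − c‖. -/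
/-- A vector of minimal norm on the line through it in direction `b` is orthogonal to `b`. -/
theorem inner_eq_zero_of_forall_norm_le_norm_add_smul
    {U : Type*} [NormedAddCommGroup U] [InnerProductSpace ℝ U] {a b : U}
    (h : ∀ t : ℝ, ‖a‖ ≤ ‖a + t • b‖) : inner ℝ a b = 0 := by
  have hquad : ∀ t : ℝ, 0 ≤ ‖b‖ ^ 2 * (t * t) + 2 * inner ℝ a b * t + 0 := fun t => by
    have hsq := pow_le_pow_left₀ (norm_nonneg a) (h t) 2
    rw [norm_add_sq_real, inner_smul_right, norm_smul, mul_pow, Real.norm_eq_abs, sq_abs] at hsq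
    linarith
  have hdiscrim := discrim_le_zero hquad
  rw [discrim] at hdiscrim
  nlinarith [sq_nonneg (inner ℝ a b)]

/-- Any center of symmetry of a nonempty set is a Chebyshev center. -/
theorem iSup_norm_sub_le_of_pointReflection_mem
    {U : Type*} [NormedAddCommGroup U] [NormedSpace ℝ U] {S : Set U} {x : U}
    (hne : S.Nonempty) (hsymm : ∀ v ∈ S, x - (v - x) ∈ S) (c : U) :
    (⨆ v : S, ‖(v : U) - x‖) ≤ ⨆ v : S, ‖(v : U) - c‖ := by
  have : Nonempty S := hne.to_subtype
  by_cases hbdd : BddAbove (Set.range fun v : S => ‖(v : U) - c‖)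
  · refine ciSup_le fun v => ?_
    have hv := le_ciSup hbdd v
    have hv' := le_ciSup hbdd ⟨_, hsymm v v.2⟩
    have htri := norm_sub_le ((v : U) - c) (x - (v - x) - c)
    rw [show ((v : U) - c) - (x - (v - x) - c) = (2 : ℝ) • ((v : U) - x) by module,
      norm_smul, Real.norm_ofNat] at htri
    dsimp only at hv hv'
    linarith
  · have hbdd' : ¬ BddAbove (Set.range fun v : S => ‖(v : U) - x‖) := by
      rintro ⟨M, hM⟩
      refine hbdd ⟨M + ‖x - c‖, ?_⟩
      rintro _ ⟨v, rfl⟩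
      have hv := hM ⟨v, rfl⟩
      have htri := norm_sub_le_norm_sub_add_norm_sub (v : U) x c
      dsimp only at hv ⊢
      linarith
    rw [Real.iSup_of_not_bddAbove hbdd, Real.iSup_of_not_bddAbove hbdd']


/-- The one-space (PBDW) estimate is the Chebyshev center of the cylinder slice:
if `K_w = K(U_n, ε) ∩ (w + W⊥)` is nonempty, then the PBDW estimate `u*(w)` belongs to
`K_w` and minimizes `c ↦ sup_{v ∈ K_w} ‖v − c‖` over all `c ∈ U`. -/
theorem pbdw_is_chebyshev_center
    {U : Type*} [NormedAddCommGroup U] [InnerProductSpace ℝ U] [CompleteSpace U]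
    (W : Submodule ℝ U) [FiniteDimensional ℝ W]
    (Un : Submodule ℝ U) [FiniteDimensional ℝ Un]
    (hUW : Un ⊓ Wᗮ = ⊥) (ε : ℝ) (hε : 0 ≤ ε) (w : W)
    (Kw : Set U)
    (hKw : Kw = {u : U | Metric.infDist u (Un : Set U) ≤ ε ∧ (u - (w : U)) ∈ Wᗮ})
    (hne : Kw.Nonempty)
    (ustar : U)
    (hustar : (ustar - (w : U)) ∈ Wᗮ ∧
      ∀ u : U, (u - (w : U)) ∈ Wᗮ →
        Metric.infDist ustar (Un : Set U) ≤ Metric.infDist u (Un : Set U)) :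
    ustar ∈ Kw ∧
    ∀ c : U, (⨆ v : Kw, ‖(v : U) - ustar‖) ≤ ⨆ v : Kw, ‖(v : U) - c‖ := by
  subst hKw
  obtain ⟨hmem, hmin⟩ := hustar
  refine ⟨?_, iSup_norm_sub_le_of_pointReflection_mem hne ?_⟩
  · obtain ⟨v, hv, hvw⟩ := hne
    exact ⟨(hmin v hvw).trans hv, hmem⟩
  · simp only [Submodule.infDist_eq_norm_starProjection_orthogonal] at hmin
    rintro v ⟨hv, hvw⟩
    have hh : v - ustar ∈ Wᗮ := by
      simpa only [sub_sub_sub_cancel_right] using Wᗮ.sub_mem hvw hmem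
    have horth : inner ℝ (Unᗮ.starProjection ustar) (Unᗮ.starProjection (v - ustar)) = 0 := by
      refine inner_eq_zero_of_forall_norm_le_norm_add_smul fun t => ?_
      rw [← map_smul, ← map_add]
      refine hmin _ ?_
      rw [add_sub_right_comm]
      exact Wᗮ.add_mem hmem (Wᗮ.smul_mem t hh)
    constructor
    · rw [Submodule.infDist_eq_norm_starProjection_orthogonal] at hv ⊢
      rwa [map_sub, norm_sub_eq_norm_add (𝕜 := ℝ) ((real_inner_comm _ _).trans horth), ← map_add,
        add_sub_cancel]
    · rw [sub_right_comm]
      exact Wᗮ.sub_mem hmem hh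
end
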